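/- Let s > 2. There exists a constant C = C(s) > 0 such that for every smooth divergence-free vector field b = (b¹,b²,b³) on 𝕋³ and every smooth ℝ²-valued function φ on 𝕋³ with 𝒫φ = φ, one has ‖[𝒫, b·∇] φ‖_{H^s} ≤ C ( ‖b‖_{H^{s+1}} ‖φ‖_{H^s} + ‖∂_z(b¹,b²)‖_{H^{s−1}} ‖φ‖_{H^{s+1}} ). -/

import Mathlib

/-!
We model functions on the torus `𝕋³ = ℝ³/ℤ³` by their Fourier coefficients,
indexed by `n ∈ ℤ³` (the actual frequency being `k = 2πn ∈ 2πℤ³`).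
Smoothness corresponds to rapid decay of the Fourier coefficients, real-valuedness
to the usual conjugation symmetry, products to convolution of coefficients, and
the `L²` norm/inner product are given by Plancherel.
-/

noncomputable section

open scoped BigOperators
open Complex

/-- Fourier frequencies of functions on `𝕋³`, indexed by `n ∈ ℤ³`; the actual
frequency is `k = 2πn ∈ 2πℤ³`. -/
abbrev Z3 : Type := Fin 3 → ℤ

/-- The Euclidean length `|k|` of the frequency `k = 2πn`. -/
def knorm (n : Z3) : ℝ := 2 * Real.pi * Real.sqrt (∑ i, ((n i : ℝ)) ^ 2)

/-- `Λ^s = (−Δ)^{s/2}` as a Fourier multiplier: `(Λ^s f)^_k = |k|^s f^_k`. -/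
def lam (s : ℝ) (c : Z3 → ℂ) : Z3 → ℂ :=
  fun n => Complex.ofReal (knorm n ^ s) * c n

/-- Squared `L²(𝕋³)` norm (Plancherel). -/
def l2sq (c : Z3 → ℂ) : ℝ := ∑' n : Z3, ‖c n‖ ^ 2

/-- `L²(𝕋³)` norm. -/
def l2norm (c : Z3 → ℂ) : ℝ := Real.sqrt (l2sq c)

/-- `L²(𝕋³)` inner product of two real-valued functions (Plancherel). -/
def inner2 (c d : Z3 → ℂ) : ℝ := (∑' n : Z3, c n * (starRingEnd ℂ) (d n)).re

/-- Sobolev `H^σ` norm: `(∑_k (1+|k|^{2σ})|f^_k|²)^{1/2}`. -/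
def hnorm (σ : ℝ) (c : Z3 → ℂ) : ℝ :=
  Real.sqrt (∑' n : Z3, (1 + knorm n ^ (2 * σ)) * ‖c n‖ ^ 2)

/-- The partial derivative `∂_j` as a Fourier multiplier. -/
def pd (j : Fin 3) (c : Z3 → ℂ) : Z3 → ℂ :=
  fun n => Complex.I * Complex.ofReal (2 * Real.pi * (n j : ℝ)) * c n

/-- Pointwise product of two functions = convolution of Fourier coefficients. -/
def conv (c d : Z3 → ℂ) : Z3 → ℂ := fun n => ∑' m : Z3, c m * d (n - m)

/-- The coefficients of a real-valued function. -/
def IsRealFn (c : Z3 → ℂ) : Prop := ∀ n : Z3, c (-n) = (starRingEnd ℂ) (c n)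

/-- Rapid decay of the Fourier coefficients, i.e. smoothness of the function. -/
def RapidDecay (c : Z3 → ℂ) : Prop :=
  ∀ N : ℕ, ∃ C : ℝ, ∀ n : Z3, ‖c n‖ * (1 + knorm n) ^ N ≤ C

/-- A smooth real-valued function on `𝕋³`, described by its Fourier coefficients. -/
def SmoothFun (c : Z3 → ℂ) : Prop := IsRealFn c ∧ RapidDecay c

/-- Zero mean. -/
def ZeroMean (c : Z3 → ℂ) : Prop := c 0 = 0

/-- A divergence-free vector field `b = (b¹,b²,b³)`: `∀ k, ∑_j k_j b^j_k = 0`. -/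
def DivFree (b : Fin 3 → Z3 → ℂ) : Prop :=
  ∀ n : Z3, ∑ j : Fin 3, (n j : ℂ) * b j n = 0

/-- The transport operator `b·∇ = b¹∂_{x₁} + b²∂_{x₂} + b³∂_z`. -/
def transport (b : Fin 3 → Z3 → ℂ) (c : Z3 → ℂ) : Z3 → ℂ :=
  fun n => ∑ j : Fin 3, conv (b j) (pd j c) n

/-- The commutator `[Λ^s, b·∇]`. -/
def commLam (s : ℝ) (b : Fin 3 → Z3 → ℂ) (c : Z3 → ℂ) : Z3 → ℂ :=
  lam s (transport b c) - transport b (lam s c)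

/-- `H^σ` norm of a 3-component vector field. -/
def hnormV3 (σ : ℝ) (b : Fin 3 → Z3 → ℂ) : ℝ :=
  Real.sqrt (∑ j : Fin 3, (hnorm σ (b j)) ^ 2)

/-- `Λ^s` acting componentwise on ℝ²-valued functions. -/
def lamV (s : ℝ) (V : Fin 2 → Z3 → ℂ) : Fin 2 → Z3 → ℂ := fun i => lam s (V i)

/-- `b·∇` acting componentwise on ℝ²-valued functions. -/
def transportV (b : Fin 3 → Z3 → ℂ) (V : Fin 2 → Z3 → ℂ) : Fin 2 → Z3 → ℂ :=
  fun i => transport b (V i)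

/-- `[Λ^s, b·∇]` acting componentwise on ℝ²-valued functions. -/
def commLamV (s : ℝ) (b : Fin 3 → Z3 → ℂ) (V : Fin 2 → Z3 → ℂ) : Fin 2 → Z3 → ℂ :=
  fun i => commLam s b (V i)

/-- `L²` norm of an ℝ²-valued function. -/
def l2normV (V : Fin 2 → Z3 → ℂ) : ℝ := Real.sqrt (∑ i : Fin 2, l2sq (V i))

/-- `L²` inner product of ℝ²-valued functions. -/
def inner2V (V W : Fin 2 → Z3 → ℂ) : ℝ := ∑ i : Fin 2, inner2 (V i) (W i)

/-- `H^σ` norm of an ℝ²-valued function. -/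
def hnormV2 (σ : ℝ) (V : Fin 2 → Z3 → ℂ) : ℝ :=
  Real.sqrt (∑ i : Fin 2, (hnorm σ (V i)) ^ 2)

/-- The hydrostatic Leray projection `𝒫φ = φ − ∇_h Δ_h^{-1} ∇_h · φ̄` as a Fourier
multiplier: the barotropic part `φ̄` consists of the modes with `n₃ = 0`, on which
`∇_h Δ_h^{-1} ∇_h ·` acts as `φ̂ ↦ n_h (n_h · φ̂)/|n_h|²` (for `n_h ≠ 0`). -/
def hproj (V : Fin 2 → Z3 → ℂ) : Fin 2 → Z3 → ℂ := fun i n =>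
  if n 2 = 0 ∧ ¬(n 0 = 0 ∧ n 1 = 0) then
    V i n - (n i.castSucc : ℂ) * ((n 0 : ℂ) * V 0 n + (n 1 : ℂ) * V 1 n) /
      (((n 0 : ℂ)) ^ 2 + ((n 1 : ℂ)) ^ 2)
  else V i n

/-- `ℚ = I − 𝒫`. -/
def qproj (V : Fin 2 → Z3 → ℂ) : Fin 2 → Z3 → ℂ := fun i => V i - hproj V i

/-- The commutator `[𝒫, b·∇]` on ℝ²-valued functions. -/
def commProj (b : Fin 3 → Z3 → ℂ) (V : Fin 2 → Z3 → ℂ) : Fin 2 → Z3 → ℂ :=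
  fun i => hproj (transportV b V) i - transportV b (hproj V) i

/-- A smooth ℝ²-valued function on `𝕋³`. -/
def SmoothV2 (V : Fin 2 → Z3 → ℂ) : Prop := ∀ i, SmoothFun (V i)

/-- A smooth vector field on `𝕋³`. -/
def SmoothV3 (b : Fin 3 → Z3 → ℂ) : Prop := ∀ j, SmoothFun (b j)

/-- `∂_z b^h = ∂_z (b¹, b²)`. -/
def dzbh (b : Fin 3 → Z3 → ℂ) : Fin 2 → Z3 → ℂ := fun i => pd 2 (b i.castSucc)

/-- `𝒫B V = 𝒫(b·∇V)`. -/
def PB (b : Fin 3 → Z3 → ℂ) (V : Fin 2 → Z3 → ℂ) : Fin 2 → Z3 → ℂ :=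
  hproj (transportV b V)


/-! ### Auxiliary lemmas in `ℝ≥0∞` -/

open scoped ENNReal

lemma aux_cs {ι : Type*} (h a w : ι → ℝ≥0∞) (hh : ∀ i, h i ^ 2 ≤ a i * w i) :
    (∑' i, h i) ^ 2 ≤ (∑' i, a i) * ∑' i, w i := by
  have key : ∀ t : Finset ι, (∑ i ∈ t, h i) ^ 2 ≤ (∑' i, a i) * ∑' i, w i := by
    intro t
    have h1 : ∀ i, h i ≤ a i ^ (1 / 2 : ℝ) * w i ^ (1 / 2 : ℝ) := by
      intro i
      have := ENNReal.rpow_le_rpow (hh i) (z := (1 / 2 : ℝ)) (by norm_num)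
      rw [ENNReal.mul_rpow_of_nonneg _ _ (by norm_num), ← ENNReal.rpow_natCast,
        ← ENNReal.rpow_mul] at this
      simpa using this
    have h2 : ∑ i ∈ t, h i ≤ (∑ i ∈ t, a i) ^ (1 / 2 : ℝ) * (∑ i ∈ t, w i) ^ (1 / 2 : ℝ) := by
      refine (Finset.sum_le_sum fun i _ => h1 i).trans ?_
      have := ENNReal.inner_le_Lp_mul_Lq t (fun i => a i ^ (1 / 2 : ℝ))
        (fun i => w i ^ (1 / 2 : ℝ)) (p := 2) (q := 2) Real.HolderConjugate.two_two
      have e : ∀ x : ℝ≥0∞, (x ^ (1 / 2 : ℝ)) ^ (2 : ℝ) = x := by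
        intro x
        rw [← ENNReal.rpow_mul]
        norm_num
      simp only [e] at this
      exact this
    have h3 : (∑ i ∈ t, h i) ^ 2 ≤ (∑ i ∈ t, a i) * (∑ i ∈ t, w i) := by
      refine (pow_le_pow_left' h2 2).trans ?_
      rw [mul_pow, ← ENNReal.rpow_natCast, ← ENNReal.rpow_natCast, ← ENNReal.rpow_mul,
        ← ENNReal.rpow_mul]
      simp
    exact h3.trans (mul_le_mul' (ENNReal.sum_le_tsum t) (ENNReal.sum_le_tsum t))
  have hl : Filter.Tendsto (fun t : Finset ι => (∑ i ∈ t, h i) ^ 2) Filter.atTop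
      (nhds ((∑' i, h i) ^ 2)) :=
    ((ENNReal.continuous_pow 2).tendsto _).comp ENNReal.summable.hasSum
  exact le_of_tendsto' hl key

lemma aux_young (f g : Z3 → ℝ≥0∞) :
    ∑' n, (∑' m, f m * g (n - m)) ^ 2 ≤ (∑' m, f m) ^ 2 * ∑' m, g m ^ 2 := by
  have h1 : ∀ n, (∑' m, f m * g (n - m)) ^ 2 ≤ (∑' m, f m) * ∑' m, f m * g (n - m) ^ 2 := by
    intro n
    apply aux_cs
    intro m
    apply le_of_eq
    ring
  refine (ENNReal.tsum_le_tsum h1).trans ?_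
  rw [ENNReal.tsum_mul_left, ENNReal.tsum_comm, sq, mul_assoc]
  gcongr
  rw [← ENNReal.tsum_mul_right]
  apply ENNReal.tsum_le_tsum
  intro m
  rw [ENNReal.tsum_mul_left]
  refine mul_le_mul' le_rfl ?_
  exact ((Equiv.subRight m).tsum_eq (fun n => g n ^ 2)).le

lemma aux_young' (f g : Z3 → ℝ≥0∞) :
    ∑' n, (∑' m, f m * g (n - m)) ^ 2 ≤ (∑' m, f m ^ 2) * (∑' m, g m) ^ 2 := by
  have : ∀ n, ∑' m, f m * g (n - m) = ∑' m, g m * f (n - m) := by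
    intro n
    rw [← (Equiv.subLeft n).tsum_eq]
    simp [mul_comm]
  simp_rw [this]
  rw [mul_comm]
  exact aux_young g f

lemma aux_sq3 (a b c : ℝ≥0∞) : (a + b + c) ^ 2 ≤ 3 * (a ^ 2 + b ^ 2 + c ^ 2) := by
  have := aux_cs (ι := Fin 3) ![a, b, c] 1 ![a ^ 2, b ^ 2, c ^ 2] (by
    intro i; fin_cases i <;> simp)
  simpa [tsum_fintype, Fin.sum_univ_three] using this

/-! ### Frequencies -/

/-- Euclidean length of the integer index. -/
def eN (n : Z3) : ℝ := Real.sqrt (∑ i, ((n i : ℝ)) ^ 2)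

/-- `max 1 |k|`. -/
def mu1 (k : ℤ) : ℝ := max 1 |(k : ℝ)|

/-- The summable weight. -/
def wA (s : ℝ) (n : Z3) : ℝ :=
  mu1 (n 0) ^ (-(s - 1)) * (mu1 (n 1) ^ (-(s - 1)) * mu1 (n 2) ^ (-2 : ℝ))

lemma knorm_eq (n : Z3) : knorm n = 2 * Real.pi * eN n := rfl

lemma eN_nonneg (n : Z3) : 0 ≤ eN n := Real.sqrt_nonneg _

lemma knorm_nonneg (n : Z3) : 0 ≤ knorm n := by
  rw [knorm_eq]; have := eN_nonneg n; positivity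

lemma two_pi_ge : (1 : ℝ) ≤ 2 * Real.pi := by
  have := Real.pi_gt_three; linarith

lemma eN_le_knorm (n : Z3) : eN n ≤ knorm n := by
  rw [knorm_eq]
  exact le_mul_of_one_le_left (eN_nonneg n) two_pi_ge

lemma eN_eq_norm (n : Z3) : eN n = ‖(WithLp.toLp 2 (fun i => (n i : ℝ)) : EuclideanSpace ℝ (Fin 3))‖ := by
  simp [eN, EuclideanSpace.norm_eq]

lemma eN_add_le (m p : Z3) : eN (m + p) ≤ eN m + eN p := by
  simp only [eN_eq_norm]
  refine le_trans (le_of_eq ?_) (norm_add_le _ _)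
  congr 1
  ext i
  simp

lemma abs_le_eN (n : Z3) (i : Fin 3) : |(n i : ℝ)| ≤ eN n := by
  rw [← Real.sqrt_sq_eq_abs]
  apply Real.sqrt_le_sqrt
  exact Finset.single_le_sum (f := fun i => (n i : ℝ) ^ 2) (fun i _ => sq_nonneg _)
    (Finset.mem_univ i)

lemma one_le_mu1 (k : ℤ) : 1 ≤ mu1 k := le_max_left _ _

lemma mu1_pos (k : ℤ) : 0 < mu1 k := lt_of_lt_of_le one_pos (one_le_mu1 k)

lemma mu1_le (n : Z3) (i : Fin 3) : mu1 (n i) ≤ max 1 (eN n) :=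
  max_le_max le_rfl (abs_le_eN n i)

lemma mu1_summable (r : ℝ) (hr : 1 < r) : Summable fun k : ℤ => mu1 k ^ (-r) := by
  have h1 : Summable fun k : ℤ => |(k : ℝ)| ^ (-r) := Real.summable_abs_int_rpow hr
  have h2 : Summable fun k : ℤ => if k = 0 then (1 : ℝ) else 0 :=
    summable_of_ne_finset_zero (s := {0}) (by intro b hb; simp at hb; simp [hb])
  refine Summable.of_nonneg_of_le (fun k => Real.rpow_nonneg (mu1_pos k).le _) ?_ (h1.add h2)
  intro k
  by_cases hk : k = 0
  · subst hk
    simp only [mu1, Int.cast_zero, abs_zero, if_true]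
    have : (0 : ℝ) ≤ 0 ^ (-r) := Real.rpow_nonneg le_rfl _
    simp
    linarith
  · have : (1 : ℝ) ≤ |(k : ℝ)| := by
      exact_mod_cast Int.one_le_abs hk
    simp [mu1, hk, max_eq_right this]

lemma wA_pos (s : ℝ) (n : Z3) : 0 < wA s n := by
  have := mu1_pos (n 0)
  have := mu1_pos (n 1)
  have := mu1_pos (n 2)
  unfold wA
  positivity

lemma wA_summable (s : ℝ) (hs : 2 < s) : Summable (wA s) := by
  have h1 := mu1_summable (s - 1) (by linarith)
  have h2 := mu1_summable 2 (by norm_num)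
  have nn : ∀ r : ℝ, 0 ≤ fun k : ℤ => mu1 k ^ (-r) :=
    fun r k => Real.rpow_nonneg (mu1_pos k).le _
  have h3 := h1.mul_of_nonneg (h1.mul_of_nonneg h2 (nn _) (nn _)) (nn _)
    (fun k => mul_nonneg (nn _ _) (nn _ _))
  let e : Z3 ≃ ℤ × ℤ × ℤ :=
    { toFun := fun n => (n 0, n 1, n 2)
      invFun := fun q => ![q.1, q.2.1, q.2.2]
      left_inv := fun n => by ext i; fin_cases i <;> rfl
      right_inv := fun q => rfl }
  exact (e.summable_iff).2 h3

lemma wA_inv_le (s : ℝ) (hs : 2 < s) (n : Z3) :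
    1 ≤ wA s n * (max 1 (eN n) ^ (2 * (s - 1)) * mu1 (n 2) ^ 2) := by
  have p0 := mu1_pos (n 0)
  have p1 := mu1_pos (n 1)
  have p2 := mu1_pos (n 2)
  have hM : 0 < max 1 (eN n) := lt_of_lt_of_le one_pos (le_max_left _ _)
  have e0 : mu1 (n 0) ^ (s - 1) ≤ max 1 (eN n) ^ (s - 1) :=
    Real.rpow_le_rpow p0.le (mu1_le n 0) (by linarith)
  have e1 : mu1 (n 1) ^ (s - 1) ≤ max 1 (eN n) ^ (s - 1) :=
    Real.rpow_le_rpow p1.le (mu1_le n 1) (by linarith)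
  have e2 : max 1 (eN n) ^ (2 * (s - 1)) = max 1 (eN n) ^ (s - 1) * max 1 (eN n) ^ (s - 1) := by
    rw [← Real.rpow_add hM]; congr 1; ring
  have e3 : 1 = wA s n * (mu1 (n 0) ^ (s - 1) * mu1 (n 1) ^ (s - 1) * mu1 (n 2) ^ 2) := by
    unfold wA
    rw [Real.rpow_neg p0.le, Real.rpow_neg p1.le, Real.rpow_neg p2.le, Real.rpow_two]
    field_simp
  rw [e2]
  calc (1 : ℝ) = _ := e3
    _ ≤ _ := by
      have := wA_pos s n
      gcongr

lemma max_rpow_le (n : Z3) (r : ℝ) (hr : 0 ≤ r) : max 1 (eN n) ^ r ≤ 1 + knorm n ^ r := by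
  have hk := Real.rpow_nonneg (knorm_nonneg n) r
  rcases le_total (eN n) 1 with h | h
  · rw [max_eq_left h]; simp [hk]
  · rw [max_eq_right h]
    have := Real.rpow_le_rpow (eN_nonneg n) (eN_le_knorm n) hr
    linarith

lemma wt1 (s : ℝ) (hs : 2 < s) (n : Z3) : 1 ≤ wA s n * (1 + knorm n ^ (2 * s)) := by
  have hM : 0 < max 1 (eN n) := lt_of_lt_of_le one_pos (le_max_left _ _)
  refine (wA_inv_le s hs n).trans ?_
  have := wA_pos s n
  gcongr
  refine le_trans ?_ (max_rpow_le n (2 * s) (by linarith))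
  have : max 1 (eN n) ^ (2 * s) = max 1 (eN n) ^ (2 * (s - 1)) * max 1 (eN n) ^ 2 := by
    rw [← Real.rpow_two, ← Real.rpow_add hM]; congr 1; ring
  rw [this]
  have := (mu1_pos (n 2)).le
  have := mu1_le n 2
  gcongr

lemma wt2 (s : ℝ) (hs : 2 < s) (n : Z3) :
    eN n ^ 2 ≤ wA s n * (1 + knorm n ^ (2 * (s + 1))) := by
  have hM : 0 < max 1 (eN n) := lt_of_lt_of_le one_pos (le_max_left _ _)
  have hN := eN_nonneg n
  have hw := wA_pos s n
  calc eN n ^ 2 = 1 * eN n ^ 2 := (one_mul _).symm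
    _ ≤ wA s n * (max 1 (eN n) ^ (2 * (s - 1)) * mu1 (n 2) ^ 2) * eN n ^ 2 := by
        gcongr; exact wA_inv_le s hs n
    _ ≤ wA s n * (max 1 (eN n) ^ (2 * (s - 1)) * max 1 (eN n) ^ 2) * max 1 (eN n) ^ 2 := by
        have := (mu1_pos (n 2)).le
        have := mu1_le n 2
        gcongr
        exact le_max_right _ _
    _ = wA s n * max 1 (eN n) ^ (2 * (s + 1)) := by
        have : max 1 (eN n) ^ (2 * (s + 1)) =
            max 1 (eN n) ^ (2 * (s - 1)) * max 1 (eN n) ^ 2 * max 1 (eN n) ^ 2 := by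
          rw [← Real.rpow_two, ← Real.rpow_add hM, ← Real.rpow_add hM]; congr 1; ring
        rw [this]; ring
    _ ≤ _ := by
        gcongr
        exact max_rpow_le n _ (by linarith)

lemma wt3 (s : ℝ) (hs : 2 < s) (n : Z3) (hn : n 2 ≠ 0) :
    1 ≤ wA s n * ((1 + knorm n ^ (2 * (s - 1))) * (2 * Real.pi * (n 2 : ℝ)) ^ 2) := by
  refine (wA_inv_le s hs n).trans ?_
  have := wA_pos s n
  have h1 : (1 : ℝ) ≤ |(n 2 : ℝ)| := by exact_mod_cast Int.one_le_abs hn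
  have h2 : mu1 (n 2) ^ 2 ≤ (2 * Real.pi * (n 2 : ℝ)) ^ 2 := by
    rw [mu1, max_eq_right h1, sq_abs, mul_pow]
    exact le_mul_of_one_le_left (sq_nonneg _) (one_le_pow₀ two_pi_ge)
  have h3 := knorm_nonneg n
  gcongr
  exact max_rpow_le n _ (by linarith)

/-! ### Smooth functions -/

lemma rd_summable {c : Z3 → ℂ} (h : RapidDecay c) (σ : ℝ) (hσ : 0 ≤ σ) :
    Summable fun n => (1 + knorm n ^ (2 * σ)) * ‖c n‖ ^ 2 := by
  obtain ⟨C, hC⟩ := h (⌈σ⌉₊ + 3)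
  refine Summable.of_nonneg_of_le ?_ ?_ ((wA_summable 3 (by norm_num)).mul_left (2 * C ^ 2))
  · intro n
    have := Real.rpow_nonneg (knorm_nonneg n) (2 * σ)
    positivity
  · intro n
    have hk := knorm_nonneg n
    have hw := wA_pos 3 n
    have h0 : knorm n ^ (2 * σ) ≤ (1 + knorm n) ^ (2 * ⌈σ⌉₊) := by
      calc knorm n ^ (2 * σ) ≤ (1 + knorm n) ^ (2 * σ) :=
            Real.rpow_le_rpow hk (by linarith) (by linarith)
        _ ≤ (1 + knorm n) ^ (((2 * ⌈σ⌉₊ : ℕ)) : ℝ) := by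
            apply Real.rpow_le_rpow_of_exponent_le (by linarith)
            push_cast
            linarith [Nat.le_ceil σ]
        _ = _ := Real.rpow_natCast _ _
    have h1 : 1 + knorm n ^ (2 * σ) ≤ 2 * (1 + knorm n) ^ (2 * ⌈σ⌉₊) := by
      have : 1 ≤ (1 + knorm n) ^ (2 * ⌈σ⌉₊) := one_le_pow₀ (by linarith)
      linarith
    have h2 : 1 ≤ wA 3 n * (1 + knorm n) ^ 6 := by
      refine (wt1 3 (by norm_num) n).trans ?_
      gcongr
      have : knorm n ^ (2 * (3 : ℝ)) = knorm n ^ 6 := by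
        rw [show (2 * (3 : ℝ)) = ((6 : ℕ) : ℝ) by norm_num, Real.rpow_natCast]
      rw [this]
      have := pow_le_pow_left₀ hk (show knorm n ≤ 1 + knorm n by linarith)
      have e : (1 + knorm n) ^ 6 = 1 + knorm n ^ 6 + (6 * knorm n + 15 * knorm n ^ 2 +
        20 * knorm n ^ 3 + 15 * knorm n ^ 4 + 6 * knorm n ^ 5) := by ring
      rw [e]
      exact le_add_of_nonneg_right (by positivity)
    have h3 : (‖c n‖ * (1 + knorm n) ^ (⌈σ⌉₊ + 3)) ^ 2 ≤ C ^ 2 :=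
      pow_le_pow_left₀ (by positivity) (hC n) 2
    calc (1 + knorm n ^ (2 * σ)) * ‖c n‖ ^ 2
        ≤ (2 * (1 + knorm n) ^ (2 * ⌈σ⌉₊)) * ‖c n‖ ^ 2 * 1 := by rw [mul_one]; gcongr
      _ ≤ (2 * (1 + knorm n) ^ (2 * ⌈σ⌉₊)) * ‖c n‖ ^ 2 * (wA 3 n * (1 + knorm n) ^ 6) := by
          gcongr
      _ = 2 * (‖c n‖ * (1 + knorm n) ^ (⌈σ⌉₊ + 3)) ^ 2 * wA 3 n := by ring
      _ ≤ _ := by gcongr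

lemma rd_pd {c : Z3 → ℂ} (h : RapidDecay c) (j : Fin 3) : RapidDecay (pd j c) := by
  intro N
  obtain ⟨C, hC⟩ := h (N + 1)
  refine ⟨C, fun n => (le_trans ?_ (hC n))⟩
  have hk := knorm_nonneg n
  have h1 : ‖pd j c n‖ ≤ (1 + knorm n) * ‖c n‖ := by
    have : ‖pd j c n‖ = 2 * Real.pi * |(n j : ℝ)| * ‖c n‖ := by
      simp [pd, abs_of_pos Real.pi_pos]
    rw [this]
    gcongr
    have h2 := abs_le_eN n j
    have h3 : 2 * Real.pi * |(n j : ℝ)| ≤ 2 * Real.pi * eN n := by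
      have := Real.pi_pos
      gcongr
    rw [← knorm_eq] at h3
    linarith
  calc ‖pd j c n‖ * (1 + knorm n) ^ N ≤ (1 + knorm n) * ‖c n‖ * (1 + knorm n) ^ N := by gcongr
    _ = _ := by ring

lemma rd_bdd {c : Z3 → ℂ} (h : RapidDecay c) : ∃ C : ℝ, ∀ n, ‖c n‖ ≤ C := by
  obtain ⟨C, hC⟩ := h 0
  exact ⟨C, fun n => by simpa using hC n⟩

lemma rd_norm_summable {c : Z3 → ℂ} (h : RapidDecay c) : Summable fun n => ‖c n‖ := by
  obtain ⟨C, hC⟩ := h 6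
  refine Summable.of_nonneg_of_le (fun n => norm_nonneg _) ?_
    ((wA_summable 3 (by norm_num)).mul_left C)
  intro n
  have hk := knorm_nonneg n
  have hw := wA_pos 3 n
  have h2 : 1 ≤ wA 3 n * (1 + knorm n) ^ 6 := by
    refine (wt1 3 (by norm_num) n).trans ?_
    gcongr
    have : knorm n ^ (2 * (3 : ℝ)) = knorm n ^ 6 := by
      rw [show (2 * (3 : ℝ)) = ((6 : ℕ) : ℝ) by norm_num, Real.rpow_natCast]
    rw [this]
    have e : (1 + knorm n) ^ 6 = 1 + knorm n ^ 6 + (6 * knorm n + 15 * knorm n ^ 2 +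
      20 * knorm n ^ 3 + 15 * knorm n ^ 4 + 6 * knorm n ^ 5) := by ring
    rw [e]
    exact le_add_of_nonneg_right (by positivity)
  calc ‖c n‖ = ‖c n‖ * 1 := (mul_one _).symm
    _ ≤ ‖c n‖ * (wA 3 n * (1 + knorm n) ^ 6) := by gcongr
    _ = (‖c n‖ * (1 + knorm n) ^ 6) * wA 3 n := by ring
    _ ≤ _ := by gcongr; exact hC n

lemma conv_summable {c d : Z3 → ℂ} (hc : RapidDecay c) (hd : RapidDecay d) (n : Z3) :
    Summable fun m => c m * d (n - m) := by
  obtain ⟨C, hC⟩ := rd_bdd hd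
  refine Summable.of_norm_bounded ((rd_norm_summable hc).mul_right C) ?_
  intro m
  rw [norm_mul]
  gcongr
  exact hC _

lemma hnorm_sq (σ : ℝ) (c : Z3 → ℂ) :
    hnorm σ c ^ 2 = ∑' n, (1 + knorm n ^ (2 * σ)) * ‖c n‖ ^ 2 := by
  unfold hnorm
  rw [Real.sq_sqrt]
  refine tsum_nonneg fun n => ?_
  have := Real.rpow_nonneg (knorm_nonneg n) (2 * σ)
  positivity

lemma ofReal_hnorm {c : Z3 → ℂ} (h : RapidDecay c) (σ : ℝ) (hσ : 0 ≤ σ) :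
    ∑' n, ENNReal.ofReal ((1 + knorm n ^ (2 * σ)) * ‖c n‖ ^ 2) =
      ENNReal.ofReal (hnorm σ c ^ 2) := by
  rw [hnorm_sq, ENNReal.ofReal_tsum_of_nonneg _ (rd_summable h σ hσ)]
  intro n
  have := Real.rpow_nonneg (knorm_nonneg n) (2 * σ)
  positivity

lemma ofReal_hnorm_le (c : Z3 → ℂ) (σ : ℝ) :
    ENNReal.ofReal (hnorm σ c ^ 2) ≤
      ∑' n, ENNReal.ofReal ((1 + knorm n ^ (2 * σ)) * ‖c n‖ ^ 2) := by
  rw [hnorm_sq]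
  by_cases h : Summable fun n => (1 + knorm n ^ (2 * σ)) * ‖c n‖ ^ 2
  · rw [ENNReal.ofReal_tsum_of_nonneg _ h]
    intro n
    have := Real.rpow_nonneg (knorm_nonneg n) (2 * σ)
    positivity
  · rw [tsum_eq_zero_of_not_summable h]
    simp

lemma div_identity (b : Fin 3 → Z3 → ℂ) (hb : SmoothV3 b) (hdiv : DivFree b)
    (φ : Fin 2 → Z3 → ℂ) (hφ : SmoothV2 φ) (n : Z3) (hn : n 2 = 0) :
    (n 0 : ℂ) * transportV b φ 0 n + (n 1 : ℂ) * transportV b φ 1 n =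
      ∑' m, Complex.I * (2 * Real.pi : ℝ) * ((n 0 : ℂ) * b 0 m + (n 1 : ℂ) * b 1 m) *
        ((n 0 : ℂ) * φ 0 (n - m) + (n 1 : ℂ) * φ 1 (n - m)) := by
  have hs : ∀ i j, HasSum (fun m => b j m * pd j (φ i) (n - m)) (conv (b j) (pd j (φ i)) n) :=
    fun i j => (conv_summable (hb j).2 (rd_pd (hφ i).2 j) n).hasSum
  have ht : ∀ i, HasSum (fun m => ∑ j : Fin 3, b j m * pd j (φ i) (n - m))
      (transportV b φ i n) := fun i => hasSum_sum fun j _ => hs i j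
  rw [← (((ht 0).mul_left (n 0 : ℂ)).add ((ht 1).mul_left (n 1 : ℂ))).tsum_eq]
  apply tsum_congr
  intro m
  have hd := hdiv m
  simp only [Fin.sum_univ_three] at hd ⊢
  simp only [pd, Pi.sub_apply, hn]
  push_cast
  linear_combination (-Complex.I * 2 * Real.pi *
    ((n 0 : ℂ) * φ 0 (n - m) + (n 1 : ℂ) * φ 1 (n - m))) * hd

lemma proj_zero (φ : Fin 2 → Z3 → ℂ) (h : hproj φ = φ) (p : Z3) (hp : p 2 = 0) :
    (p 0 : ℂ) * φ 0 p + (p 1 : ℂ) * φ 1 p = 0 := by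
  by_cases h0 : p 0 = 0 ∧ p 1 = 0
  · simp [h0.1, h0.2]
  have e : ∀ i : Fin 2, (p i.castSucc : ℂ) * ((p 0 : ℂ) * φ 0 p + (p 1 : ℂ) * φ 1 p) /
      (((p 0 : ℂ)) ^ 2 + ((p 1 : ℂ)) ^ 2) = 0 := by
    intro i
    have := congrFun (congrFun h i) p
    simp only [hproj] at this
    rw [if_pos ⟨hp, h0⟩] at this
    linear_combination -this
  have hne : ((p 0 : ℂ)) ^ 2 + ((p 1 : ℂ)) ^ 2 ≠ 0 := by
    have : (p 0) ^ 2 + (p 1) ^ 2 ≠ 0 := by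
      intro h
      apply h0
      constructor <;> nlinarith [sq_nonneg (p 0), sq_nonneg (p 1)]
    exact_mod_cast this
  have e0 := e 0
  have e1 := e 1
  simp only [div_eq_zero_iff, hne, or_false, mul_eq_zero] at e0 e1
  rcases e0 with e0 | e0
  · rcases e1 with e1 | e1
    · exfalso
      apply h0
      constructor
      · simpa using e0
      · simpa using e1
    · exact e1
  · exact e0

lemma two_norm_le (n : Z3) (x y : ℂ) : ‖(n 0 : ℂ) * x + (n 1 : ℂ) * y‖ ≤ eN n * (‖x‖ + ‖y‖) := by
  refine (norm_add_le _ _).trans ?_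
  rw [norm_mul, norm_mul, mul_add]
  have h0 := abs_le_eN n 0
  have h1 := abs_le_eN n 1
  simp only [Complex.norm_intCast]
  gcongr

lemma pt_ineq1 (s x y z : ℝ) (hs : 2 < s) (hx : 0 ≤ x) (hy : 0 ≤ y) (hz : 0 ≤ z)
    (h : x ≤ y + z) : x ^ s * y ≤ 2 ^ (s + 1) * (y ^ (s + 1) + y * z ^ s) := by
  have e : ∀ t : ℝ, 0 ≤ t → t ^ (s + 1) = t ^ s * t := by
    intro t ht
    rw [Real.rpow_add_of_nonneg ht (by linarith) (by norm_num), Real.rpow_one]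
  rw [e 2 (by norm_num), e y hy]
  have hys := Real.rpow_nonneg hy s
  have hzs := Real.rpow_nonneg hz s
  have h2s := Real.rpow_nonneg (show (0 : ℝ) ≤ 2 by norm_num) s
  have hxs : x ^ s ≤ 2 ^ s * (y ^ s + z ^ s) := by
    rcases le_total y z with hyz | hyz
    · have := Real.rpow_le_rpow hx (show x ≤ 2 * z by linarith) (show 0 ≤ s by linarith)
      rw [Real.mul_rpow (by norm_num) hz] at this
      nlinarith [mul_nonneg h2s hys]
    · have := Real.rpow_le_rpow hx (show x ≤ 2 * y by linarith) (show 0 ≤ s by linarith)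
      rw [Real.mul_rpow (by norm_num) hy] at this
      nlinarith [mul_nonneg h2s hzs]
  have := mul_le_mul_of_nonneg_right hxs hy
  have h4 : 0 ≤ 2 ^ s * (y ^ s + z ^ s) * y := by positivity
  nlinarith

lemma pt_ineq2 (s x y z : ℝ) (hs : 2 < s) (hx : 0 ≤ x) (hy : 0 ≤ y) (hz : 0 ≤ z)
    (h : x ≤ y + z) : x ^ s * x ≤ 2 ^ (s + 1) * (y ^ (s + 1) + z ^ (s + 1)) := by
  have e : ∀ t : ℝ, 0 ≤ t → t ^ (s + 1) = t ^ s * t := by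
    intro t ht
    rw [Real.rpow_add_of_nonneg ht (by linarith) (by norm_num), Real.rpow_one]
  rw [← e x hx]
  have hys := Real.rpow_nonneg hy (s + 1)
  have hzs := Real.rpow_nonneg hz (s + 1)
  have h2s := Real.rpow_nonneg (show (0 : ℝ) ≤ 2 by norm_num) (s + 1)
  rcases le_total y z with hyz | hyz
  · have := Real.rpow_le_rpow hx (show x ≤ 2 * z by linarith) (show 0 ≤ s + 1 by linarith)
    rw [Real.mul_rpow (by norm_num) hz] at this
    nlinarith [mul_nonneg h2s hys]
  · have := Real.rpow_le_rpow hx (show x ≤ 2 * y by linarith) (show 0 ≤ s + 1 by linarith)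
    rw [Real.mul_rpow (by norm_num) hy] at this
    nlinarith [mul_nonneg h2s hzs]

/-- Sum of the moduli of two components. -/
def nn2 (x y : Z3 → ℂ) (n : Z3) : ℝ := ‖x n‖ + ‖y n‖

lemma nn2_nonneg (x y : Z3 → ℂ) (n : Z3) : 0 ≤ nn2 x y n := by
  unfold nn2; positivity

/-- `β` restricted to the modes with nonzero vertical frequency. -/
def nnz (x y : Z3 → ℂ) (n : Z3) : ℝ := if n 2 = 0 then 0 else nn2 x y n

lemma nnz_nonneg (x y : Z3 → ℂ) (n : Z3) : 0 ≤ nnz x y n := by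
  unfold nnz; split_ifs
  · exact le_rfl
  · exact nn2_nonneg _ _ _

lemma term_bound (s : ℝ) (hs : 2 < s) (b : Fin 3 → Z3 → ℂ)
    (φ : Fin 2 → Z3 → ℂ) (hP : hproj φ = φ) (n m : Z3) (hn : n 2 = 0) :
    eN n ^ s * (nn2 (b 0) (b 1) m * ‖(n 0 : ℂ) * φ 0 (n - m) + (n 1 : ℂ) * φ 1 (n - m)‖) ≤
      2 ^ (s + 1) * (
        (eN m ^ (s + 1) * nn2 (b 0) (b 1) m) * nn2 (φ 0) (φ 1) (n - m) +
        (eN m * nn2 (b 0) (b 1) m) * (eN (n - m) ^ s * nn2 (φ 0) (φ 1) (n - m)) +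
        nnz (b 0) (b 1) m * (eN (n - m) ^ (s + 1) * nn2 (φ 0) (φ 1) (n - m))) := by
  have hN := eN_nonneg n
  have hM := eN_nonneg m
  have hp := eN_nonneg (n - m)
  have htri : eN n ≤ eN m + eN (n - m) := by
    have := eN_add_le m (n - m)
    simpa using this
  have hB := nn2_nonneg (b 0) (b 1) m
  have hF := nn2_nonneg (φ 0) (φ 1) (n - m)
  have r1 := Real.rpow_nonneg hM (s + 1)
  have r2 := Real.rpow_nonneg hp s
  have r3 := Real.rpow_nonneg hp (s + 1)
  have r4 := Real.rpow_nonneg hN s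
  have r5 := Real.rpow_nonneg (show (0 : ℝ) ≤ 2 by norm_num) (s + 1)
  by_cases h : m 2 = 0
  · have h1 : ‖(n 0 : ℂ) * φ 0 (n - m) + (n 1 : ℂ) * φ 1 (n - m)‖ ≤
        eN m * nn2 (φ 0) (φ 1) (n - m) := by
      have hz := proj_zero φ hP (n - m) (by simp [hn, h])
      have : (n 0 : ℂ) * φ 0 (n - m) + (n 1 : ℂ) * φ 1 (n - m) =
          (m 0 : ℂ) * φ 0 (n - m) + (m 1 : ℂ) * φ 1 (n - m) := by
        simp only [Pi.sub_apply] at hz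
        push_cast at hz
        linear_combination hz
      rw [this]
      exact two_norm_le m _ _
    have h2 := pt_ineq1 s _ _ _ hs hN hM hp htri
    have h3 : nnz (b 0) (b 1) m = 0 := by simp [nnz, h]
    rw [h3]
    calc _ ≤ eN n ^ s * (nn2 (b 0) (b 1) m * (eN m * nn2 (φ 0) (φ 1) (n - m))) := by gcongr
      _ = (eN n ^ s * eN m) * (nn2 (b 0) (b 1) m * nn2 (φ 0) (φ 1) (n - m)) := by ring
      _ ≤ (2 ^ (s + 1) * (eN m ^ (s + 1) + eN m * eN (n - m) ^ s)) *
          (nn2 (b 0) (b 1) m * nn2 (φ 0) (φ 1) (n - m)) := by gcongr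
      _ = _ := by ring
  · have h1 := two_norm_le n (φ 0 (n - m)) (φ 1 (n - m))
    change _ ≤ eN n * nn2 (φ 0) (φ 1) (n - m) at h1
    have h2 := pt_ineq2 s _ _ _ hs hN hM hp htri
    have h3 : nnz (b 0) (b 1) m = nn2 (b 0) (b 1) m := by simp [nnz, h]
    rw [h3]
    calc _ ≤ eN n ^ s * (nn2 (b 0) (b 1) m * (eN n * nn2 (φ 0) (φ 1) (n - m))) := by gcongr
      _ = (eN n ^ s * eN n) * (nn2 (b 0) (b 1) m * nn2 (φ 0) (φ 1) (n - m)) := by ring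
      _ ≤ (2 ^ (s + 1) * (eN m ^ (s + 1) + eN (n - m) ^ (s + 1))) *
          (nn2 (b 0) (b 1) m * nn2 (φ 0) (φ 1) (n - m)) := by gcongr
      _ ≤ _ := by
        have : 0 ≤ 2 ^ (s + 1) * ((eN m * nn2 (b 0) (b 1) m) *
          (eN (n - m) ^ s * nn2 (φ 0) (φ 1) (n - m))) := by positivity
        nlinarith

lemma commProj_zero (b : Fin 3 → Z3 → ℂ) (φ : Fin 2 → Z3 → ℂ) (hP : hproj φ = φ)
    (n : Z3) (hn : ¬ (n 2 = 0 ∧ ¬(n 0 = 0 ∧ n 1 = 0))) (i : Fin 2) :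
    commProj b φ i n = 0 := by
  simp only [commProj, hP, Pi.sub_apply]
  simp only [hproj]
  rw [if_neg hn, sub_self]

lemma eN_ge_one (n : Z3) (hn : n 2 = 0 ∧ ¬(n 0 = 0 ∧ n 1 = 0)) : 1 ≤ eN n := by
  by_cases h : n 0 = 0
  · have h1 : n 1 ≠ 0 := fun h1 => hn.2 ⟨h, h1⟩
    refine le_trans ?_ (abs_le_eN n 1)
    exact_mod_cast Int.one_le_abs h1
  · refine le_trans ?_ (abs_le_eN n 0)
    exact_mod_cast Int.one_le_abs h

lemma commProj_norm (b : Fin 3 → Z3 → ℂ) (φ : Fin 2 → Z3 → ℂ) (hP : hproj φ = φ)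
    (n : Z3) (hn : n 2 = 0 ∧ ¬(n 0 = 0 ∧ n 1 = 0)) (i : Fin 2) :
    ‖commProj b φ i n‖ ≤
      ‖(n 0 : ℂ) * transportV b φ 0 n + (n 1 : ℂ) * transportV b φ 1 n‖ / eN n := by
  have h1 := eN_ge_one n hn
  have e : commProj b φ i n = -((n i.castSucc : ℂ) *
      ((n 0 : ℂ) * transportV b φ 0 n + (n 1 : ℂ) * transportV b φ 1 n) /
      (((n 0 : ℂ)) ^ 2 + ((n 1 : ℂ)) ^ 2)) := by
    simp only [commProj, hP, Pi.sub_apply]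
    simp only [hproj]
    rw [if_pos hn]
    ring
  have h2 : ((n 0 : ℂ)) ^ 2 + ((n 1 : ℂ)) ^ 2 = ((eN n ^ 2 : ℝ) : ℂ) := by
    rw [eN, Real.sq_sqrt (Finset.sum_nonneg fun i _ => sq_nonneg _), Fin.sum_univ_three, hn.1]
    push_cast
    ring
  rw [e, h2, norm_neg, norm_div, norm_mul, Complex.norm_intCast, Complex.norm_real,
    Real.norm_of_nonneg (by positivity)]
  have h3 := abs_le_eN n i.castSucc
  rw [div_le_div_iff₀ (by positivity) (by positivity)]
  have := norm_nonneg ((n 0 : ℂ) * transportV b φ 0 n + (n 1 : ℂ) * transportV b φ 1 n)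
  calc _ ≤ (eN n * ‖(n 0 : ℂ) * transportV b φ 0 n + (n 1 : ℂ) * transportV b φ 1 n‖) * eN n := by
        gcongr
    _ = _ := by ring

/-! ### The main estimate -/

lemma pw_bound (s : ℝ) (hs : 2 < s) (b : Fin 3 → Z3 → ℂ) (hb : SmoothV3 b) (hdiv : DivFree b)
    (φ : Fin 2 → Z3 → ℂ) (hφ : SmoothV2 φ) (hP : hproj φ = φ) (i : Fin 2) (n : Z3) :
    ENNReal.ofReal ((1 + knorm n ^ (2 * s)) * ‖commProj b φ i n‖ ^ 2) ≤
      ENNReal.ofReal (2 * ((2 * Real.pi) ^ (s + 1) * 2 ^ (s + 1)) ^ 2) *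
      ((∑' m, ENNReal.ofReal (eN m ^ (s + 1) * nn2 (b 0) (b 1) m) *
          ENNReal.ofReal (nn2 (φ 0) (φ 1) (n - m))) +
       (∑' m, ENNReal.ofReal (eN m * nn2 (b 0) (b 1) m) *
          ENNReal.ofReal (eN (n - m) ^ s * nn2 (φ 0) (φ 1) (n - m))) +
       (∑' m, ENNReal.ofReal (nnz (b 0) (b 1) m) *
          ENNReal.ofReal (eN (n - m) ^ (s + 1) * nn2 (φ 0) (φ 1) (n - m)))) ^ 2 := by
  by_cases hn : n 2 = 0 ∧ ¬(n 0 = 0 ∧ n 1 = 0)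
  swap
  · rw [commProj_zero b φ hP n hn i]
    simp
  have h1 := eN_ge_one n hn
  have hpi := Real.pi_pos
  have hk1 : 1 ≤ knorm n := h1.trans (eN_le_knorm n)
  set D := (n 0 : ℂ) * transportV b φ 0 n + (n 1 : ℂ) * transportV b φ 1 n with hD
  have hq := commProj_norm b φ hP n hn i
  rw [← hD] at hq
  have hks : 0 ≤ knorm n ^ s := Real.rpow_nonneg (knorm_nonneg n) s
  have e1 : (1 + knorm n ^ (2 * s)) * ‖commProj b φ i n‖ ^ 2 ≤
      2 * (knorm n ^ s / eN n * ‖D‖) ^ 2 := by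
    have h2 : knorm n ^ (2 * s) = (knorm n ^ s) ^ 2 := by
      rw [mul_comm, Real.rpow_mul (knorm_nonneg n), Real.rpow_two]
    have h3 : 1 ≤ knorm n ^ (2 * s) := Real.one_le_rpow hk1 (by linarith)
    calc (1 + knorm n ^ (2 * s)) * ‖commProj b φ i n‖ ^ 2
        ≤ (2 * knorm n ^ (2 * s)) * (‖D‖ / eN n) ^ 2 := by
          gcongr
          linarith
      _ = _ := by rw [h2]; ring
  set C0 : ℝ := (2 * Real.pi) ^ (s + 1) * 2 ^ (s + 1) with hC0
  have hC0' : 0 ≤ C0 := by positivity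
  have e2 : ENNReal.ofReal (knorm n ^ s / eN n * ‖D‖) ≤ ENNReal.ofReal C0 *
      ((∑' m, ENNReal.ofReal (eN m ^ (s + 1) * nn2 (b 0) (b 1) m) *
          ENNReal.ofReal (nn2 (φ 0) (φ 1) (n - m))) +
       (∑' m, ENNReal.ofReal (eN m * nn2 (b 0) (b 1) m) *
          ENNReal.ofReal (eN (n - m) ^ s * nn2 (φ 0) (φ 1) (n - m))) +
       (∑' m, ENNReal.ofReal (nnz (b 0) (b 1) m) *
          ENNReal.ofReal (eN (n - m) ^ (s + 1) * nn2 (φ 0) (φ 1) (n - m)))) := by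
    rw [← ENNReal.tsum_add, ← ENNReal.tsum_add, ← ENNReal.tsum_mul_left,
      ENNReal.ofReal_mul (by positivity), ofReal_norm, hD,
      div_identity b hb hdiv φ hφ n hn.1]
    refine (mul_le_mul' le_rfl enorm_tsum_le_tsum_enorm).trans ?_
    rw [← ENNReal.tsum_mul_left]
    apply ENNReal.tsum_le_tsum
    intro m
    have n1 := nn2_nonneg (b 0) (b 1) m
    have n2 := nn2_nonneg (φ 0) (φ 1) (n - m)
    have n3 := nnz_nonneg (b 0) (b 1) m
    have n4 := eN_nonneg m
    have n5 := eN_nonneg (n - m)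
    have r1 := Real.rpow_nonneg n4 (s + 1)
    have r2 := Real.rpow_nonneg n5 (s + 1)
    have r3 := Real.rpow_nonneg n5 s
    rw [← ofReal_norm, ← ENNReal.ofReal_mul (by positivity), ← ENNReal.ofReal_mul (by positivity),
      ← ENNReal.ofReal_mul (by positivity), ← ENNReal.ofReal_mul (by positivity),
      ← ENNReal.ofReal_add (by positivity) (by positivity),
      ← ENNReal.ofReal_add (by positivity) (by positivity), ← ENNReal.ofReal_mul (by positivity)]
    apply ENNReal.ofReal_le_ofReal
    have tb := term_bound s hs b φ hP n m hn.1
    have h2 := two_norm_le n (b 0 m) (b 1 m)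
    change _ ≤ eN n * nn2 (b 0) (b 1) m at h2
    rw [norm_mul, norm_mul, norm_mul, Complex.norm_I, Complex.norm_real,
      Real.norm_of_nonneg (by positivity), one_mul]
    have hk : knorm n ^ s = (2 * Real.pi) ^ s * eN n ^ s := by
      rw [knorm_eq, Real.mul_rpow (by positivity) (by positivity)]
    have hpp : (2 * Real.pi) ^ (s + 1) = (2 * Real.pi) ^ s * (2 * Real.pi) := by
      rw [Real.rpow_add (by positivity), Real.rpow_one]
    calc _ ≤ knorm n ^ s / eN n * (2 * Real.pi * (eN n * nn2 (b 0) (b 1) m) *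
          ‖(n 0 : ℂ) * φ 0 (n - m) + (n 1 : ℂ) * φ 1 (n - m)‖) := by gcongr
      _ = (2 * Real.pi) ^ (s + 1) * (eN n ^ s * (nn2 (b 0) (b 1) m *
          ‖(n 0 : ℂ) * φ 0 (n - m) + (n 1 : ℂ) * φ 1 (n - m)‖)) := by
          rw [hk, hpp]
          field_simp
      _ ≤ _ := by
          rw [hC0, mul_assoc]
          gcongr
  refine (ENNReal.ofReal_le_ofReal e1).trans ?_
  rw [ENNReal.ofReal_mul (by norm_num), ENNReal.ofReal_mul (by norm_num),
    ENNReal.ofReal_pow (by positivity), ENNReal.ofReal_pow hC0', mul_assoc, ← mul_pow]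
  gcongr

lemma nn2_sum (σ : ℝ) (hσ : 0 ≤ σ) {x y : Z3 → ℂ} (hx : RapidDecay x) (hy : RapidDecay y) :
    ∑' n, ENNReal.ofReal ((1 + knorm n ^ (2 * σ)) * nn2 x y n ^ 2) ≤
      ENNReal.ofReal (2 * (hnorm σ x ^ 2 + hnorm σ y ^ 2)) := by
  rw [ENNReal.ofReal_mul (by norm_num), ENNReal.ofReal_add (by positivity) (by positivity),
    ← ofReal_hnorm hx σ hσ, ← ofReal_hnorm hy σ hσ, ← ENNReal.tsum_add, ← ENNReal.tsum_mul_left]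
  apply ENNReal.tsum_le_tsum
  intro n
  have := Real.rpow_nonneg (knorm_nonneg n) (2 * σ)
  rw [← ENNReal.ofReal_add (by positivity) (by positivity), ← ENNReal.ofReal_mul (by norm_num)]
  apply ENNReal.ofReal_le_ofReal
  have h : nn2 x y n ^ 2 ≤ 2 * (‖x n‖ ^ 2 + ‖y n‖ ^ 2) := by
    unfold nn2
    nlinarith [sq_nonneg (‖x n‖ - ‖y n‖)]
  calc _ ≤ (1 + knorm n ^ (2 * σ)) * (2 * (‖x n‖ ^ 2 + ‖y n‖ ^ 2)) := by gcongr
    _ = _ := by ring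

lemma nn2_l2 (σ : ℝ) (hσ : 0 ≤ σ) {x y : Z3 → ℂ} (hx : RapidDecay x) (hy : RapidDecay y) :
    ∑' n, ENNReal.ofReal (eN n ^ σ * nn2 x y n) ^ 2 ≤
      ENNReal.ofReal (2 * (hnorm σ x ^ 2 + hnorm σ y ^ 2)) := by
  refine le_trans (ENNReal.tsum_le_tsum fun n => ?_) (nn2_sum σ hσ hx hy)
  have hN := eN_nonneg n
  have h2 := nn2_nonneg x y n
  have h3 := Real.rpow_nonneg hN σ
  rw [← ENNReal.ofReal_pow (by positivity)]
  apply ENNReal.ofReal_le_ofReal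
  rw [mul_pow, ← Real.rpow_two, ← Real.rpow_mul hN, mul_comm σ 2]
  gcongr
  have := Real.rpow_le_rpow hN (eN_le_knorm n) (show 0 ≤ 2 * σ by linarith)
  linarith

lemma l1_bound (s : ℝ) (hs : 2 < s) (f w : Z3 → ℝ) (hf : ∀ n, 0 ≤ f n)
    (h : ∀ n, f n ^ 2 ≤ wA s n * w n) (B : ℝ)
    (hB : ∑' n, ENNReal.ofReal (w n) ≤ ENNReal.ofReal B) :
    (∑' n, ENNReal.ofReal (f n)) ^ 2 ≤ ENNReal.ofReal ((∑' n, wA s n) * B) := by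
  refine (aux_cs _ (fun n => ENNReal.ofReal (wA s n)) (fun n => ENNReal.ofReal (w n)) ?_).trans ?_
  · intro n
    rw [← ENNReal.ofReal_pow (hf n), ← ENNReal.ofReal_mul (wA_pos s n).le]
    exact ENNReal.ofReal_le_ofReal (h n)
  · rw [ENNReal.ofReal_mul (tsum_nonneg fun n => (wA_pos s n).le),
      ENNReal.ofReal_tsum_of_nonneg (fun n => (wA_pos s n).le) (wA_summable s hs)]
    gcongr

lemma nn2_pd (x y : Z3 → ℂ) (n : Z3) :
    nn2 (pd 2 x) (pd 2 y) n ^ 2 = (2 * Real.pi * (n 2 : ℝ)) ^ 2 * nn2 x y n ^ 2 := by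
  have : nn2 (pd 2 x) (pd 2 y) n = |2 * Real.pi * (n 2 : ℝ)| * nn2 x y n := by
    simp [nn2, pd, abs_mul]
    ring
  rw [this, mul_pow, sq_abs]

lemma main_bound (s : ℝ) (hs : 2 < s) (b : Fin 3 → Z3 → ℂ) (hb : SmoothV3 b) (hdiv : DivFree b)
    (φ : Fin 2 → Z3 → ℂ) (hφ : SmoothV2 φ) (hP : hproj φ = φ) (i : Fin 2) :
    hnorm s (commProj b φ i) ^ 2 ≤
      (2 * ((2 * Real.pi) ^ (s + 1) * 2 ^ (s + 1)) ^ 2) * (24 * ∑' n, wA s n) *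
      (hnormV3 (s + 1) b ^ 2 * hnormV2 s φ ^ 2 +
        hnormV2 (s - 1) (dzbh b) ^ 2 * hnormV2 (s + 1) φ ^ 2) := by
  set T := ∑' n, wA s n with hT
  have hT0 : 0 ≤ T := tsum_nonneg fun n => (wA_pos s n).le
  set C1 : ℝ := 2 * ((2 * Real.pi) ^ (s + 1) * 2 ^ (s + 1)) ^ 2 with hC1
  have hC1' : 0 ≤ C1 := by positivity
  have sb : ∀ j, RapidDecay (b j) := fun j => (hb j).2
  have sf : ∀ j, RapidDecay (φ j) := fun j => (hφ j).2
  set B := 2 * (hnorm (s + 1) (b 0) ^ 2 + hnorm (s + 1) (b 1) ^ 2) with hBdef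
  set F := 2 * (hnorm s (φ 0) ^ 2 + hnorm s (φ 1) ^ 2) with hFdef
  set F' := 2 * (hnorm (s + 1) (φ 0) ^ 2 + hnorm (s + 1) (φ 1) ^ 2) with hF'def
  set Z := 2 * (hnorm (s - 1) (pd 2 (b 0)) ^ 2 + hnorm (s - 1) (pd 2 (b 1)) ^ 2) with hZdef
  have B0 : 0 ≤ B := by positivity
  have F0 : 0 ≤ F := by positivity
  have F'0 : 0 ≤ F' := by positivity
  have Z0 : 0 ≤ Z := by positivity
  -- the three `ℓ¹` bounds
  have a1 : (∑' n, ENNReal.ofReal (nn2 (φ 0) (φ 1) n)) ^ 2 ≤ ENNReal.ofReal (T * F) := by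
    refine l1_bound s hs _ _ (nn2_nonneg _ _) ?_ F (nn2_sum s (by linarith) (sf 0) (sf 1))
    intro n
    rw [← mul_assoc]
    exact le_mul_of_one_le_left (sq_nonneg _) (wt1 s hs n)
  have a2 : (∑' n, ENNReal.ofReal (eN n * nn2 (b 0) (b 1) n)) ^ 2 ≤ ENNReal.ofReal (T * B) := by
    refine l1_bound s hs _ _ (fun n => mul_nonneg (eN_nonneg n) (nn2_nonneg _ _ n)) ?_ B
      (nn2_sum (s + 1) (by linarith) (sb 0) (sb 1))
    intro n
    rw [← mul_assoc, mul_pow]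
    exact mul_le_mul_of_nonneg_right (wt2 s hs n) (sq_nonneg _)
  have a3 : (∑' n, ENNReal.ofReal (nnz (b 0) (b 1) n)) ^ 2 ≤ ENNReal.ofReal (T * Z) := by
    refine l1_bound s hs _ _ (nnz_nonneg _ _) ?_ Z
      (nn2_sum (s - 1) (by linarith) (rd_pd (sb 0) 2) (rd_pd (sb 1) 2))
    intro n
    have hw := wA_pos s n
    have hk := Real.rpow_nonneg (knorm_nonneg n) (2 * (s - 1))
    unfold nnz
    split_ifs with h
    · rw [zero_pow two_ne_zero]
      exact mul_nonneg hw.le (mul_nonneg (by linarith) (sq_nonneg _))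
    · rw [nn2_pd, ← mul_assoc, ← mul_assoc, mul_assoc (wA s n)]
      exact le_mul_of_one_le_left (sq_nonneg _) (wt3 s hs n h)
  have c1 := nn2_l2 (s + 1) (by linarith) (sb 0) (sb 1)
  have c2 := nn2_l2 s (by linarith) (sf 0) (sf 1)
  have c3 := nn2_l2 (s + 1) (by linarith) (sf 0) (sf 1)
  have y1 := (aux_young' (fun m => ENNReal.ofReal (eN m ^ (s + 1) * nn2 (b 0) (b 1) m))
    (fun p => ENNReal.ofReal (nn2 (φ 0) (φ 1) p))).trans (mul_le_mul' c1 a1)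
  have y2 := (aux_young (fun m => ENNReal.ofReal (eN m * nn2 (b 0) (b 1) m))
    (fun p => ENNReal.ofReal (eN p ^ s * nn2 (φ 0) (φ 1) p))).trans (mul_le_mul' a2 c2)
  have y3 := (aux_young (fun m => ENNReal.ofReal (nnz (b 0) (b 1) m))
    (fun p => ENNReal.ofReal (eN p ^ (s + 1) * nn2 (φ 0) (φ 1) p))).trans (mul_le_mul' a3 c3)
  rw [← ENNReal.ofReal_mul (by positivity)] at y1 y2 y3
  have main : ENNReal.ofReal (hnorm s (commProj b φ i) ^ 2) ≤
      ENNReal.ofReal (C1 * (3 * (B * (T * F) + T * B * F + T * Z * F'))) := by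
    refine (ofReal_hnorm_le _ _).trans ?_
    refine (ENNReal.tsum_le_tsum fun n => pw_bound s hs b hb hdiv φ hφ hP i n).trans ?_
    rw [ENNReal.tsum_mul_left, ENNReal.ofReal_mul hC1']
    refine mul_le_mul' le_rfl ?_
    refine (ENNReal.tsum_le_tsum fun n => aux_sq3 _ _ _).trans ?_
    rw [ENNReal.tsum_mul_left, ENNReal.tsum_add, ENNReal.tsum_add,
      ENNReal.ofReal_mul (by norm_num), ENNReal.ofReal_add (by positivity) (by positivity),
      ENNReal.ofReal_add (by positivity) (by positivity)]
    refine mul_le_mul' (by simp) ?_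
    exact add_le_add (add_le_add y1 y2) y3
  have main' := (ENNReal.ofReal_le_ofReal_iff (by positivity)).1 main
  refine main'.trans ?_
  have eB : B ≤ 2 * hnormV3 (s + 1) b ^ 2 := by
    rw [hnormV3, Real.sq_sqrt (by positivity), Fin.sum_univ_three]
    nlinarith [sq_nonneg (hnorm (s + 1) (b 2))]
  have eF : F = 2 * hnormV2 s φ ^ 2 := by
    rw [hnormV2, Real.sq_sqrt (by positivity), Fin.sum_univ_two]
  have eF' : F' = 2 * hnormV2 (s + 1) φ ^ 2 := by
    rw [hnormV2, Real.sq_sqrt (by positivity), Fin.sum_univ_two]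
  have eZ : Z = 2 * hnormV2 (s - 1) (dzbh b) ^ 2 := by
    rw [hnormV2, Real.sq_sqrt (by positivity), Fin.sum_univ_two]
    rfl
  have hBF : B * F ≤ 2 * hnormV3 (s + 1) b ^ 2 * (2 * hnormV2 s φ ^ 2) := by
    rw [← eF]; gcongr
  have hZF : Z * F' = 2 * hnormV2 (s - 1) (dzbh b) ^ 2 * (2 * hnormV2 (s + 1) φ ^ 2) := by
    rw [eZ, eF']
  have hpos : 0 ≤ hnormV2 (s - 1) (dzbh b) ^ 2 * hnormV2 (s + 1) φ ^ 2 := by positivity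
  calc C1 * (3 * (B * (T * F) + T * B * F + T * Z * F'))
      = C1 * T * (3 * (2 * (B * F) + Z * F')) := by ring
    _ ≤ C1 * T * (24 * (hnormV3 (s + 1) b ^ 2 * hnormV2 s φ ^ 2 +
        hnormV2 (s - 1) (dzbh b) ^ 2 * hnormV2 (s + 1) φ ^ 2)) := by
        refine mul_le_mul_of_nonneg_left ?_ (mul_nonneg hC1' hT0)
        linarith
    _ = _ := by ring

/-- Let `s > 2`. There is `C = C(s) > 0` such that for every smooth
divergence-free vector field `b = (b¹,b²,b³)` on `𝕋³` and every smooth ℝ²-valued `φ`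
with `𝒫φ = φ`,
`‖[𝒫, b·∇]φ‖_{H^s} ≤ C (‖b‖_{H^{s+1}} ‖φ‖_{H^s} + ‖∂_z(b¹,b²)‖_{H^{s−1}} ‖φ‖_{H^{s+1}})`. -/
theorem stmt3 (s : ℝ) (hs : 2 < s) :
    ∃ C : ℝ, 0 < C ∧
      ∀ b : Fin 3 → Z3 → ℂ, SmoothV3 b → DivFree b →
        ∀ φ : Fin 2 → Z3 → ℂ, SmoothV2 φ → hproj φ = φ →
          hnormV2 s (commProj b φ) ≤
            C * (hnormV3 (s + 1) b * hnormV2 s φ +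
                 hnormV2 (s - 1) (dzbh b) * hnormV2 (s + 1) φ) := by
  have hT : 0 < ∑' n, wA s n :=
    (wA_summable s hs).tsum_pos (fun n => (wA_pos s n).le) 0 (wA_pos s 0)
  have hpi := Real.pi_pos
  set K : ℝ := 2 *
    ((2 * ((2 * Real.pi) ^ (s + 1) * 2 ^ (s + 1)) ^ 2) * (24 * ∑' n, wA s n)) with hK
  have hK0 : 0 < K := by positivity
  refine ⟨Real.sqrt K, Real.sqrt_pos.2 hK0, ?_⟩
  intro b hb hdiv φ hφ hP
  have h0 := main_bound s hs b hb hdiv φ hφ hP 0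
  have h1 := main_bound s hs b hb hdiv φ hφ hP 1
  have n1 : 0 ≤ hnormV3 (s + 1) b := Real.sqrt_nonneg _
  have n2 : 0 ≤ hnormV2 s φ := Real.sqrt_nonneg _
  have n3 : 0 ≤ hnormV2 (s - 1) (dzbh b) := Real.sqrt_nonneg _
  have n4 : 0 ≤ hnormV2 (s + 1) φ := Real.sqrt_nonneg _
  rw [hnormV2, Fin.sum_univ_two]
  apply Real.sqrt_le_iff.2
  refine ⟨by positivity, ?_⟩
  rw [mul_pow, Real.sq_sqrt hK0.le]
  have hle : hnormV3 (s + 1) b ^ 2 * hnormV2 s φ ^ 2 +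
        hnormV2 (s - 1) (dzbh b) ^ 2 * hnormV2 (s + 1) φ ^ 2 ≤
      (hnormV3 (s + 1) b * hnormV2 s φ + hnormV2 (s - 1) (dzbh b) * hnormV2 (s + 1) φ) ^ 2 := by
    have : 0 ≤ (hnormV3 (s + 1) b * hnormV2 s φ) *
      (hnormV2 (s - 1) (dzbh b) * hnormV2 (s + 1) φ) := by positivity
    nlinarith
  refine le_trans ?_ (mul_le_mul_of_nonneg_left hle hK0.le)
  rw [hK]
  linarith
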